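/- arXiv:2006.13449 — 2 statements merged into one kernel-verified Lean document; each statement's English description precedes it below -/
import Mathlib

section
/- Let G be a simple graph on vertex set {v_1,…,v_n}, let S_1,…,S_n be strings of length m over an alphabet Σ', and let Y_1,…,Y_n,Y'_1,…,Y'_n be the block strings built from the Jiang–Li strings of G. If G contains a clique of size k, then there exists a common subsequence of Y_1,…,Y_n,Y'_1,…,Y'_n of length at least k·m. -/
/-- The maximum length of a common subsequence of two strings (lists). -/
noncomputable def lcsLen {α : Type*} (S T : List α) : ℕ :=
  sSup {k | ∃ Z : List α, Z.Sublist S ∧ Z.Sublist T ∧ Z.length = k}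

/-- The Jiang–Li string `X_i`. -/
def JLX {n : ℕ} (G : SimpleGraph (Fin n)) [DecidableRel G.Adj] (i : Fin n) : List (Fin n) :=
  (List.finRange n).filter (fun j => decide (j ≠ i)) ++ [i] ++
    (List.finRange n).filter (fun j => decide (G.Adj i j ∧ i < j))

/-- The Jiang–Li string `X'_i`. -/
def JLX' {n : ℕ} (G : SimpleGraph (Fin n)) [DecidableRel G.Adj] (i : Fin n) : List (Fin n) :=
  (List.finRange n).filter (fun j => decide (G.Adj i j ∧ j < i)) ++ [i] ++
    (List.finRange n).filter (fun j => decide (j ≠ i))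

/-- The block string `Y_i`, obtained from `X_i` by replacing each symbol `v_j`
by the string `S j`. -/
def JLY {n : ℕ} {A : Type*} (G : SimpleGraph (Fin n)) [DecidableRel G.Adj]
    (S : Fin n → List A) (i : Fin n) : List A :=
  ((JLX G i).map S).flatten

/-- The block string `Y'_i`, obtained from `X'_i` by replacing each symbol `v_j`
by the string `S j`. -/
def JLY' {n : ℕ} {A : Type*} (G : SimpleGraph (Fin n)) [DecidableRel G.Adj]
    (S : Fin n → List A) (i : Fin n) : List A :=
  ((JLX' G i).map S).flatten

theorem sub_filter_aux {n : ℕ} (a : List (Fin n)) (p : Fin n → Bool)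
    (h : a.Sublist (List.finRange n)) (hp : ∀ x ∈ a, p x = true) :
    a.Sublist ((List.finRange n).filter p) := by
  have := h.filter p
  rwa [List.filter_eq_self.2 hp] at this

theorem flatten_map_sublist_aux {B A : Type*} (S : B → List A) {l₁ l₂ : List B}
    (h : l₁.Sublist l₂) : ((l₁.map S).flatten).Sublist ((l₂.map S).flatten) := by
  induction h with
  | slnil => simp
  | cons a _ ih => simpa using ih.trans (List.sublist_append_right _ _)
  | cons_cons a _ ih => simpa using ih

theorem clique_sublist_aux {n k : ℕ} (G : SimpleGraph (Fin n)) [DecidableRel G.Adj]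
    (s : Finset (Fin n)) (hclique : G.IsNClique k s) (i : Fin n) :
    ((List.finRange n).filter (fun j => decide (j ∈ s))).Sublist (JLX G i) ∧
    ((List.finRange n).filter (fun j => decide (j ∈ s))).Sublist (JLX' G i) := by
  have hsub : ((List.finRange n).filter (fun j => decide (j ∈ s))).Sublist (List.finRange n) :=
    List.filter_sublist
  have hmem : ∀ x ∈ (List.finRange n).filter (fun j => decide (j ∈ s)), x ∈ s := by
    intro x hx
    simpa using hx
  have hiff : i ∈ (List.finRange n).filter (fun j => decide (j ∈ s)) ↔ i ∈ s := by simp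
  have hsort : ((List.finRange n).filter (fun j => decide (j ∈ s))).Pairwise (· < ·) :=
    (List.pairwise_lt_finRange n).sublist hsub
  have hcl : ∀ x ∈ s, ∀ y ∈ s, x ≠ y → G.Adj x y := by
    intro x hx y hy hxy
    exact hclique.isClique hx hy hxy
  generalize (List.finRange n).filter (fun j => decide (j ∈ s)) = Z at *
  unfold JLX JLX'
  by_cases hi : i ∈ s
  · obtain ⟨a, b, rfl⟩ := List.append_of_mem (hiff.2 hi)
    rw [List.pairwise_append, List.pairwise_cons] at hsort
    obtain ⟨-, ⟨hb, -⟩, hab⟩ := hsort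
    have ha : ∀ x ∈ a, x < i := fun x hx => hab x hx i (by simp)
    have hsa : a.Sublist (List.finRange n) := (List.sublist_append_left _ _).trans hsub
    have hsb : b.Sublist (List.finRange n) :=
      ((List.sublist_cons_self i b).trans (List.sublist_append_right _ _)).trans hsub
    have e : a ++ i :: b = a ++ [i] ++ b := by simp
    have hma : ∀ x ∈ a, x ∈ s := fun x hx => hmem x (by simp [hx])
    have hmb : ∀ x ∈ b, x ∈ s := fun x hx => hmem x (by simp [hx])
    rw [e]
    constructor
    · refine List.Sublist.append (List.Sublist.append (sub_filter_aux _ _ hsa ?_)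
        (List.Sublist.refl _)) (sub_filter_aux _ _ hsb ?_)
      · intro x hx
        simpa using (ha x hx).ne
      · intro x hx
        simpa using ⟨hcl i hi x (hmb x hx) (hb x hx).ne, hb x hx⟩
    · refine List.Sublist.append (List.Sublist.append (sub_filter_aux _ _ hsa ?_)
        (List.Sublist.refl _)) (sub_filter_aux _ _ hsb ?_)
      · intro x hx
        simpa using ⟨hcl i hi x (hma x hx) (ha x hx).ne', ha x hx⟩
      · intro x hx
        simpa using (hb x hx).ne'
  · have h : Z.Sublist ((List.finRange n).filter (fun j => decide (j ≠ i))) := by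
      refine sub_filter_aux _ _ hsub ?_
      intro x hx
      have : x ≠ i := fun h => hi (h ▸ hmem x hx)
      simpa using this
    refine ⟨?_, h.trans (List.sublist_append_right _ _)⟩
    rw [List.append_assoc]
    exact h.trans (List.sublist_append_left _ _)

/-- If `G` contains a clique of size `k`, then there is a common subsequence of
`Y_1, …, Y_n, Y'_1, …, Y'_n` of length at least `k·m`. -/
theorem stmt6 {n m k : ℕ} {A : Type*} (G : SimpleGraph (Fin n)) [DecidableRel G.Adj]
    (S : Fin n → List A) (hSlen : ∀ j, (S j).length = m)
    (s : Finset (Fin n)) (hclique : G.IsNClique k s) :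
    ∃ L : List A, (∀ i : Fin n, L.Sublist (JLY G S i) ∧ L.Sublist (JLY' G S i)) ∧
      k * m ≤ L.length := by
  refine ⟨(((List.finRange n).filter (fun j => decide (j ∈ s))).map S).flatten, fun i => ?_, ?_⟩
  · obtain ⟨h1, h2⟩ := clique_sublist_aux G s hclique i
    exact ⟨flatten_map_sublist_aux S h1, flatten_map_sublist_aux S h2⟩
  · have hk : k ≤ ((List.finRange n).filter (fun j => decide (j ∈ s))).length := by
      rw [← hclique.card_eq]
      calc s.card ≤ ((List.finRange n).filter (fun j => decide (j ∈ s))).toFinset.card := by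
            apply Finset.card_le_card
            intro x hx
            simpa using hx
        _ ≤ _ := List.toFinset_card_le _
    have hl : ∀ l : List (Fin n), ((l.map S).flatten).length = l.length * m := by
      intro l
      induction l with
      | nil => simp
      | cons a l ih =>
        rw [List.map_cons, List.flatten_cons, List.length_append, ih, hSlen, List.length_cons]
        ring
    rw [hl]
    exact Nat.mul_le_mul_right m hk
end

section
/- Assume the block setup. Let i ∈ W. (a) Suppose σ is an alignment of L_1 into Y_i under which Z_i is 1/2-aligned with the segment S_{i+1}⋯S_n S_i S_{i_r}⋯S_{i_s} of Y_i, and there exists j ∈ W with j > i such that σ maps some position of Z_j to a position inside the block S_j lying within the segment S_{i+1}⋯S_n S_i of Y_i. Then there exists r with i < r ≤ j and |C[i,r−1]| ≤ (2α/β)·(r−i). (b) Suppose σ' is an alignment of L_1 into Y'_i under which Z_i is 1/2-aligned with the segment S_{i_p}⋯S_{i_q} S_i S_1⋯S_{i−1} of Y'_i, and there exists j ∈ W with j < i such that σ' maps some position of Z_j to a position inside the block S_j lying within the segment S_i S_1⋯S_{i−1} of Y'_i. Then there exists r with j ≤ r < i and |C[r+1,i]| ≤ (2α/β)·(i−r).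 -/
open scoped Classical

/-- The number of neighbours of `v_i` with smaller index, i.e. `|N_<(v_i)|`. -/
def numNbrLT {n : ℕ} (G : SimpleGraph (Fin n)) [DecidableRel G.Adj] (i : Fin n) : ℕ :=
  ((List.finRange n).filter (fun j => decide (G.Adj i j ∧ j < i))).length

/-- The string `L₁ = Z_1 Z_2 ⋯ Z_n`. -/
def L1str {n : ℕ} {A : Type*} (Z : Fin n → List A) : List A :=
  ((List.finRange n).map Z).flatten

/-- The position in `L₁` at which the piece `Z_t` starts. -/
def blockOffset {n : ℕ} {A : Type*} (Z : Fin n → List A) (t : Fin n) : ℕ :=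
  ∑ s ∈ Finset.univ.filter (fun s : Fin n => s < t), (Z s).length

/-- An alignment of `L` into `Y`: a strictly increasing map on positions of `L`
under which corresponding symbols agree. -/
def IsAlignment {A : Type*} (L Y : List A) (σ : ℕ → ℕ) : Prop :=
  (∀ p q : ℕ, p < q → q < L.length → σ p < σ q) ∧
  (∀ p : ℕ, p < L.length → σ p < Y.length) ∧
  (∀ (p : ℕ) (hp : p < L.length) (hq : σ p < Y.length), L.get ⟨p, hp⟩ = Y.get ⟨σ p, hq⟩)

/-- `Z_t` is `1/2`-aligned (under `σ`) with the segment of `Y` occupying the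
positions `[lo, hi)`: all positions of the first `⌈|Z_t|/2⌉` symbols of `Z_t`, or
all positions of the last `⌈|Z_t|/2⌉` symbols of `Z_t`, are mapped into `[lo, hi)`. -/
def HalfAligned {n : ℕ} {A : Type*} (σ : ℕ → ℕ) (Z : Fin n → List A) (t : Fin n)
    (lo hi : ℕ) : Prop :=
  (∀ p : ℕ, blockOffset Z t ≤ p → p < blockOffset Z t + ((Z t).length + 1) / 2 →
      lo ≤ σ p ∧ σ p < hi) ∨
  (∀ p : ℕ, blockOffset Z t + (Z t).length - ((Z t).length + 1) / 2 ≤ p →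
      p < blockOffset Z t + (Z t).length → lo ≤ σ p ∧ σ p < hi)

/-- `σ` maps some position of `Z_j` into the positions `[lo, hi)` of the target. -/
def HitsSegment {n : ℕ} {A : Type*} (σ : ℕ → ℕ) (Z : Fin n → List A) (j : Fin n)
    (lo hi : ℕ) : Prop :=
  ∃ p : ℕ, blockOffset Z j ≤ p ∧ p < blockOffset Z j + (Z j).length ∧
    lo ≤ σ p ∧ σ p < hi

/-- `C[i,j] = {t ∈ W : i ≤ t ≤ j}` where `W = {t : Z_t ≠ ε}`. -/
noncomputable def Cset {n : ℕ} {A : Type*} (Z : Fin n → List A) (i j : Fin n) :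
    Finset (Fin n) :=
  Finset.univ.filter (fun t => Z t ≠ [] ∧ i ≤ t ∧ t ≤ j)

/-- Number of distinct pairs along two monotone maps. -/
theorem aux_count (f g : ℕ → ℕ) (a d : ℕ)
    (hf : ∀ p q, a ≤ p → p ≤ q → q ≤ a + d → f p ≤ f q)
    (hg : ∀ p q, a ≤ p → p ≤ q → q ≤ a + d → g p ≤ g q) :
    ((Finset.Icc a (a + d)).image (fun p => (f p, g p))).card + 1 ≤
      ((Finset.Icc a (a + d)).image f).card + ((Finset.Icc a (a + d)).image g).card := by
  induction d with
  | zero => simp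
  | succ d ih =>
    have ih' := ih (fun p q h1 h2 h3 => hf p q h1 h2 (by omega))
      (fun p q h1 h2 h3 => hg p q h1 h2 (by omega))
    have e : Finset.Icc a (a + (d + 1)) = insert (a + d + 1) (Finset.Icc a (a + d)) := by
      ext x; simp only [Finset.mem_Icc, Finset.mem_insert]; omega
    rw [e, Finset.image_insert, Finset.image_insert, Finset.image_insert]
    have m1 := Finset.card_le_card (Finset.subset_insert (f (a + d + 1)) ((Finset.Icc a (a + d)).image f))
    have m2 := Finset.card_le_card (Finset.subset_insert (g (a + d + 1)) ((Finset.Icc a (a + d)).image g))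
    have m3 := Finset.card_insert_le (f (a + d + 1), g (a + d + 1))
      ((Finset.Icc a (a + d)).image (fun p => (f p, g p)))
    by_cases h1 : f (a + d + 1) ∈ (Finset.Icc a (a + d)).image f
    · by_cases h2 : g (a + d + 1) ∈ (Finset.Icc a (a + d)).image g
      · have : (f (a + d + 1), g (a + d + 1)) ∈ (Finset.Icc a (a + d)).image (fun p => (f p, g p)) := by
          simp only [Finset.mem_image, Finset.mem_Icc] at h1 h2 ⊢
          obtain ⟨p, hp, hp'⟩ := h1
          obtain ⟨q, hq, hq'⟩ := h2
          refine ⟨max p q, by omega, ?_⟩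
          have a1 := hf p (max p q) (by omega) (by omega) (by omega)
          have a2 := hf (max p q) (a + d + 1) (by omega) (by omega) (by omega)
          have a3 := hg q (max p q) (by omega) (by omega) (by omega)
          have a4 := hg (max p q) (a + d + 1) (by omega) (by omega) (by omega)
          ext <;> simp only <;> omega
        rw [Finset.insert_eq_of_mem this]; omega
      · rw [Finset.card_insert_of_notMem h2]; omega
    · rw [Finset.card_insert_of_notMem h1]; omega

theorem aux_sublist {A : Type*} (l : List A) (f : ℕ → A) (g : ℕ → ℕ) (is : List ℕ) :
    ∀ k : ℕ, (∀ p ∈ is, k ≤ g p ∧ l[g p]? = some (f p)) →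
      is.Pairwise (fun p q => g p < g q) → (is.map f).Sublist (l.drop k) := by
  induction is with
  | nil => intro k _ _; simp
  | cons p is ih =>
    intro k h hp
    rw [List.pairwise_cons] at hp
    have h1 := ih (g p + 1) (fun q hq => ⟨hp.1 q hq, (h q (by simp [hq])).2⟩) hp.2
    obtain ⟨h2, h3⟩ := h p (by simp)
    obtain ⟨h4, h5⟩ := List.getElem?_eq_some_iff.mp h3
    have h6 : l.drop (g p) = f p :: l.drop (g p + 1) := by
      rw [List.drop_eq_getElem_cons h4, h5]
    have h7 : (l.drop (g p)).Sublist (l.drop k) := List.drop_sublist_drop_left l h2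
    rw [List.map_cons]
    refine List.Sublist.trans ?_ h7
    rw [h6]
    exact h1.cons_cons _

theorem aux_lcs {A : Type*} (S T U : List A) (h1 : U.Sublist S) (h2 : U.Sublist T) :
    U.length ≤ lcsLen S T := by
  apply le_csSup
  · refine ⟨S.length, ?_⟩
    rintro k ⟨Z, hZ, _, rfl⟩
    exact hZ.length_le
  · exact ⟨U, h1, h2, rfl⟩

theorem aux_flatten {n m : ℕ} {A : Type*} (S : Fin n → List A) (hS : ∀ j, (S j).length = m)
    (X : List (Fin n)) : ∀ (b q : ℕ) (s : Fin n), X[b]? = some s → q < m →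
      ((X.map S).flatten)[b * m + q]? = (S s)[q]? := by
  induction X with
  | nil => intro b q s h; simp at h
  | cons x X ih =>
    intro b q s h hq
    cases b with
    | zero =>
      simp at h; subst h
      simp [List.getElem?_append, hS, hq]
    | succ b =>
      have := ih b q s (by simpa using h) hq
      rw [List.map_cons, List.flatten_cons, List.getElem?_append_right (by rw [hS]; nlinarith), hS,
        ← this]
      congr 1
      rw [Nat.succ_mul]; omega

theorem aux_off {n : ℕ} {A : Type*} (Z : Fin n → List A) (t : Fin n) :
    blockOffset Z t = ((((List.finRange n).map Z).map List.length).take t.val).sum := by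
  unfold blockOffset
  rw [Finset.sum_filter, ← List.sum_ofFn]
  rw [List.map_map, ← List.ofFn_eq_map]
  rw [List.sum_take_ofFn]
  rw [List.sum_ofFn, Finset.sum_filter]
  rfl

theorem aux_L1 {n : ℕ} {A : Type*} (Z : Fin n → List A) (t : Fin n) (u : ℕ)
    (hu : u < (Z t).length) : (L1str Z)[blockOffset Z t + u]? = (Z t)[u]? := by
  unfold L1str
  rw [← List.getElem?_drop, aux_off, List.drop_sum_flatten]
  rw [List.drop_eq_getElem_cons (by simp), List.flatten_cons, List.getElem?_append_left (by simpa using hu)]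
  simp

theorem aux_off_split {n : ℕ} {A : Type*} (Z : Fin n → List A) (s t : Fin n) (h : s < t) :
    blockOffset Z t = blockOffset Z s + (Z s).length +
      ∑ u ∈ Finset.univ.filter (fun u : Fin n => s < u ∧ u < t), (Z u).length := by
  unfold blockOffset
  simp only [Finset.sum_filter]
  have : (Z s).length = ∑ u : Fin n, if u = s then (Z u).length else 0 := by simp
  rw [this, ← Finset.sum_add_distrib, ← Finset.sum_add_distrib]
  apply Finset.sum_congr rfl
  intro u _
  split_ifs <;> omega

theorem aux_off_le {n : ℕ} {A : Type*} (Z : Fin n → List A) (s t : Fin n) (h : s < t) :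
    blockOffset Z s + (Z s).length ≤ blockOffset Z t := by
  rw [aux_off_split Z s t h]; omega

theorem aux_len {n : ℕ} {A : Type*} (Z : Fin n → List A) (t : Fin n) :
    blockOffset Z t + (Z t).length ≤ (L1str Z).length := by
  by_cases h : (Z t).length = 0
  · rw [h, aux_off]
    unfold L1str
    rw [List.length_flatten]
    simp only [add_zero]
    exact List.Sublist.sum_le_sum (List.take_sublist _ _) (by simp)
  · have h1 := aux_L1 Z t ((Z t).length - 1) (by omega)
    have h2 : (Z t)[(Z t).length - 1]? ≠ none := by
      rw [List.getElem?_eq_getElem (by omega)]; simp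
    rw [← h1] at h2
    simp at h2
    omega

theorem aux_owner {n : ℕ} {A : Type*} (Z : Fin n → List A) (p : ℕ) (hp : p < (L1str Z).length) :
    ∃ t : Fin n, blockOffset Z t ≤ p ∧ p < blockOffset Z t + (Z t).length := by
  by_contra hcon
  push Not at hcon
  have key : ∀ k : ℕ, k ≤ n → ((((List.finRange n).map Z).map List.length).take k).sum ≤ p := by
    intro k
    induction k with
    | zero => simp
    | succ k ih =>
      intro hk
      have h1 := ih (by omega)
      have h2 := hcon ⟨k, by omega⟩
      rw [aux_off] at h2
      have h3 := h2 h1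
      rw [List.sum_take_succ _ _ (by simp; omega)]
      simpa using h3
  have := key n le_rfl
  unfold L1str at hp
  rw [List.length_flatten] at hp
  rw [List.take_of_length_le (by simp)] at this
  omega

theorem aux_core {n m : ℕ} {A : Type*} (α : ℝ)
    (S Z : Fin n → List A) (hSlen : ∀ j, (S j).length = m) (hm : 0 < m)
    (hLCS : ∀ i j : Fin n, i ≠ j → ((lcsLen (S i) (S j) : ℕ) : ℝ) ≤ α * m)
    (hsub : ∀ t, (Z t).Sublist (S t)) (X : List (Fin n)) (σ : ℕ → ℕ)
    (hσ : IsAlignment (L1str Z) ((X.map S).flatten) σ)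
    (a b lo k : ℕ) (hab : a < b) (hb : b ≤ (L1str Z).length) (T : Finset (Fin n))
    (hblk : ∀ p, a ≤ p → p < b → lo ≤ σ p / m ∧ σ p / m < lo + k)
    (hT : ∀ p t, a ≤ p → p < b → blockOffset Z t ≤ p → p < blockOffset Z t + (Z t).length →
      t ∈ T ∧ ∃ s, X[σ p / m]? = some s ∧ s ≠ t) :
    ((b - a : ℕ) : ℝ) ≤ (α * m) * ((T.card : ℝ) + k - 1) := by
  have hA : Nonempty A := by
    have : 0 < (L1str Z).length := by omega
    exact ⟨(L1str Z)[0]⟩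
  have hlenpos : ∀ p, p < b → ∃ t : Fin n, blockOffset Z t ≤ p ∧ p < blockOffset Z t + (Z t).length :=
    fun p hp => aux_owner Z p (by omega)
  obtain ⟨t0, -⟩ := hlenpos a hab
  have : ∃ τ : ℕ → Fin n, ∀ p, p < b → blockOffset Z (τ p) ≤ p ∧
      p < blockOffset Z (τ p) + (Z (τ p)).length := by
    choose τ hτ using (show ∀ p, ∃ t : Fin n, p < b → blockOffset Z t ≤ p ∧
      p < blockOffset Z t + (Z t).length from fun p => by
        by_cases hp : p < b
        · obtain ⟨t, ht⟩ := hlenpos p hp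
          exact ⟨t, fun _ => ht⟩
        · exact ⟨t0, fun h => absurd h hp⟩)
    exact ⟨τ, hτ⟩
  obtain ⟨τ, hτ⟩ := this
  obtain ⟨f, hf⟩ : ∃ f : ℕ → A, ∀ p, p < (L1str Z).length → (L1str Z)[p]? = some (f p) := by
    refine ⟨fun p => ((L1str Z)[p]?).getD (Classical.choice hA), fun p hp => ?_⟩
    simp [List.getElem?_eq_getElem hp]
  obtain ⟨d, rfl⟩ : ∃ d, b = a + d + 1 := ⟨b - a - 1, by omega⟩
  have hcount := aux_count (fun p => (τ p).val) (fun p => σ p / m) a d (by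
      intro p q h1 h2 h3
      by_contra hlt
      push Not at hlt
      have := aux_off_le Z _ _ (Fin.lt_def.mpr hlt)
      have e1 := hτ p (by omega)
      have e2 := hτ q (by omega)
      omega) (by
      intro p q h1 h2 h3
      apply Nat.div_le_div_right
      rcases h2.eq_or_lt with h | h
      · rw [h]
      · exact (hσ.1 p q h (by omega)).le)
  have c1 : ((Finset.Icc a (a + d)).image (fun p => (τ p).val)).card ≤ T.card := by
    have : (Finset.Icc a (a + d)).image (fun p => (τ p).val) ⊆ T.image Fin.val := by
      intro x hx
      simp only [Finset.mem_image, Finset.mem_Icc] at hx ⊢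
      obtain ⟨p, hp, rfl⟩ := hx
      have e := hτ p (by omega)
      exact ⟨τ p, (hT p (τ p) (by omega) (by omega) e.1 e.2).1, rfl⟩
    exact (Finset.card_le_card this).trans Finset.card_image_le
  have c2 : ((Finset.Icc a (a + d)).image (fun p => σ p / m)).card ≤ k := by
    have : (Finset.Icc a (a + d)).image (fun p => σ p / m) ⊆ Finset.Ico lo (lo + k) := by
      intro x hx
      simp only [Finset.mem_image, Finset.mem_Icc, Finset.mem_Ico] at hx ⊢
      obtain ⟨p, hp, rfl⟩ := hx
      exact hblk p (by omega) (by omega)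
    simpa using Finset.card_le_card this
  set I := (Finset.Icc a (a + d)).image (fun p => ((τ p).val, σ p / m)) with hI
  have hfib : ∀ x ∈ I, (((Finset.Icc a (a + d)).filter
      (fun p => ((τ p).val, σ p / m) = x)).card : ℝ) ≤ α * m := by
    intro x hx
    rw [hI, Finset.mem_image] at hx
    obtain ⟨p0, hp0, rfl⟩ := hx
    rw [Finset.mem_Icc] at hp0
    have e0 := hτ p0 (by omega)
    obtain ⟨-, s, hs, hst⟩ := hT p0 (τ p0) (by omega) (by omega) e0.1 e0.2
    set F := (Finset.Icc a (a + d)).filter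
      (fun p => ((τ p).val, σ p / m) = ((τ p0).val, σ p0 / m)) with hF
    have hmem : ∀ p ∈ F, a ≤ p ∧ p ≤ a + d ∧ τ p = τ p0 ∧ σ p / m = σ p0 / m := by
      intro p hp
      simp only [hF, Finset.mem_filter, Finset.mem_Icc, Prod.mk.injEq] at hp
      exact ⟨hp.1.1, hp.1.2, Fin.ext hp.2.1, hp.2.2⟩
    have hsort : (F.sort (· ≤ ·)).Pairwise (· < ·) := by
      exact F.sortedLT_sort.pairwise
    have s1 : ((F.sort (· ≤ ·)).map f).Sublist ((Z (τ p0)).drop 0) := by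
      apply aux_sublist (Z (τ p0)) f (fun p => p - blockOffset Z (τ p0))
      · intro p hp
        rw [Finset.mem_sort] at hp
        obtain ⟨h1, h2, h3, h4⟩ := hmem p hp
        have e := hτ p (by omega)
        rw [h3] at e
        refine ⟨by omega, ?_⟩
        rw [← aux_L1 Z _ _ (by omega), ← hf p (by omega)]
        congr 1; omega
      · refine hsort.imp_of_mem ?_
        intro p q hp hq hpq
        rw [Finset.mem_sort] at hp
        obtain ⟨h1, h2, h3, h4⟩ := hmem p hp
        have e := hτ p (by omega)
        rw [h3] at e
        omega
    have hdm : ∀ p ∈ F, σ p0 / m * m + σ p % m = σ p := by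
      intro p hp
      rw [← (hmem p hp).2.2.2]
      exact Nat.div_add_mod' _ _
    have s2 : ((F.sort (· ≤ ·)).map f).Sublist ((S s).drop 0) := by
      apply aux_sublist (S s) f (fun p => σ p % m)
      · intro p hp
        rw [Finset.mem_sort] at hp
        obtain ⟨h1, h2, h3, h4⟩ := hmem p hp
        refine ⟨by omega, ?_⟩
        rw [← aux_flatten S hSlen X _ _ s hs (Nat.mod_lt _ hm), hdm p hp, ← hf p (by omega)]
        have hp1 : p < (L1str Z).length := by omega
        have hp2 := hσ.2.1 p hp1
        have := hσ.2.2 p hp1 hp2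
        simp only [List.get_eq_getElem] at this
        rw [List.getElem?_eq_getElem hp1, List.getElem?_eq_getElem hp2, this]
      · refine hsort.imp_of_mem ?_
        intro p q hp hq hpq
        rw [Finset.mem_sort] at hp hq
        have h1 := hdm p hp
        have h2 := hdm q hq
        have h3 := hσ.1 p q hpq (by have := hmem q hq; omega)
        omega
    rw [List.drop_zero] at s1 s2
    have := aux_lcs _ _ _ (s1.trans (hsub _)) s2
    rw [List.length_map, Finset.length_sort] at this
    have h5 := hLCS _ _ (Ne.symm hst)
    have : (F.card : ℝ) ≤ (lcsLen (S (τ p0)) (S s) : ℝ) := by exact_mod_cast this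
    linarith
  have htot := Finset.card_eq_sum_card_fiberwise (s := Finset.Icc a (a + d)) (t := I)
    (f := fun p => ((τ p).val, σ p / m)) (fun p hp => Finset.mem_coe.mpr (Finset.mem_image_of_mem _ hp))
  have h6 : ((Finset.Icc a (a + d)).card : ℝ) ≤ I.card * (α * m) := by
    rw [htot]; push_cast
    rw [← nsmul_eq_mul]
    exact Finset.sum_le_card_nsmul _ _ _ hfib
  have h7 : ((a + d + 1 - a : ℕ) : ℝ) = ((Finset.Icc a (a + d)).card : ℝ) := by
    rw [Nat.card_Icc]
  rw [h7]
  have h8 : (I.card : ℝ) ≤ T.card + k - 1 := by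
    have : I.card + 1 ≤ T.card + k := by omega
    have : (I.card : ℝ) + 1 ≤ T.card + k := by exact_mod_cast this
    linarith
  have h9 : 0 ≤ α * m := by
    refine le_trans (Nat.cast_nonneg _) (hfib _ (Finset.mem_image_of_mem _ (Finset.left_mem_Icc.mpr (by omega))))
  nlinarith

theorem aux_arith (α β m c k P : ℝ) (hα0 : 0 < α) (hα : α < 1 / 8) (hβ : β = Real.sqrt (8 * α))
    (hm : 0 < m) (hc : 1 ≤ c) (h1 : P ≤ (α * m) * (c + k - 1))
    (h2 : β * m * (c - 1 / 2) ≤ P) : c ≤ (2 * α / β) * k := by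
  have hb : 0 < β := by rw [hβ]; positivity
  have hbb : β * β = 8 * α := by rw [hβ]; exact Real.mul_self_sqrt (by positivity)
  have hb1 : β < 1 := by nlinarith
  have e : 2 * α / β = β / 4 := by field_simp; nlinarith
  rw [e]
  have hα' : α = β * β / 8 := by linarith
  have h3 : (β * m) * (c - 1 / 2) ≤ (β * m) * (β / 8 * (c + k - 1)) := by
    calc _ ≤ _ := h2.trans h1
      _ = _ := by rw [hα']; ring
  have h4 := le_of_mul_le_mul_left h3 (by positivity)
  nlinarith

theorem aux_filter {n : ℕ} (i : Fin n) :
    (List.finRange n).filter (fun j => decide (j ≠ i)) = (List.finRange n).eraseIdx i.val := by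
  have h := (List.nodup_finRange n).erase_eq_filter i
  have h2 : (List.finRange n).filter (fun j => decide (j ≠ i)) = (List.finRange n).erase i := by
    rw [h]; congr 1; ext j; rw [Bool.eq_iff_iff]; simp
  rw [h2]
  rw [List.erase_eq_eraseIdx_of_idxOf]
  simp

theorem aux_X {n : ℕ} (G : SimpleGraph (Fin n)) [DecidableRel G.Adj] (i s : Fin n) (b : ℕ)
    (h1 : i.val ≤ b) (h2 : s.val = b + 1) : (JLX G i)[b]? = some s := by
  unfold JLX
  rw [aux_filter, List.append_assoc]
  have := s.2
  rw [List.getElem?_append_left (by rw [List.length_eraseIdx_of_lt (by simp)]; simp; omega)]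
  rw [List.getElem?_eraseIdx_of_ge h1, ← h2]
  simp

theorem aux_X' {n : ℕ} (G : SimpleGraph (Fin n)) [DecidableRel G.Adj] (i s : Fin n) 
    (h1 : s < i) : (JLX' G i)[numNbrLT G i + 1 + s.val]? = some s := by
  unfold JLX' numNbrLT
  rw [aux_filter]
  rw [List.getElem?_append_right (by simp)]
  simp only [List.length_append, List.length_singleton]
  rw [Nat.add_sub_cancel_left, List.getElem?_eraseIdx_of_lt h1]
  simp

theorem aux_sum {n : ℕ} {A : Type*} (Z : Fin n → List A) (B : ℝ) 
    (hZlen : ∀ t, Z t ≠ [] → B ≤ ((Z t).length : ℝ)) (Q : Finset (Fin n)) :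
    B * ((Q.filter (fun t => Z t ≠ [])).card : ℝ) ≤ ((∑ u ∈ Q, (Z u).length : ℕ) : ℝ) := by
  have h1 : ∑ u ∈ Q.filter (fun t => Z t ≠ []), (Z u).length ≤ ∑ u ∈ Q, (Z u).length :=
    Finset.sum_le_sum_of_subset (Finset.filter_subset _ _)
  have h2 : ((∑ u ∈ Q.filter (fun t => Z t ≠ []), (Z u).length : ℕ) : ℝ) ≤
    ((∑ u ∈ Q, (Z u).length : ℕ) : ℝ) := by exact_mod_cast h1
  refine le_trans ?_ h2
  push_cast
  rw [mul_comm, ← nsmul_eq_mul]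
  apply Finset.card_nsmul_le_sum
  intro x hx
  exact hZlen x (Finset.mem_filter.mp hx).2

/-- Claim 2 (sparse case): (a) if `Z_i` is 1/2-aligned with the segment
`S_{i+1}⋯S_n S_i S_{N_>(v_i)}` of `Y_i` and some position of `Z_j` (`j > i`) is mapped
into the block `S_j` inside `S_{i+1}⋯S_n S_i`, then there is `r` with `i < r ≤ j`
and `|C[i,r−1]| ≤ (2α/β)(r−i)`; (b) symmetrically for `Y'_i`.
(In `Y_i` the block `S_j`, `j > i`, occupies positions `[(j−1)m, jm)`; in `Y'_i` the
block `S_j`, `j < i`, occupies positions `[(d+1+j')m, (d+2+j')m)` where `d = |N_<(v_i)|`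
and `j'` is the 0-based index of `j`.  The set `{t ∈ W : i ≤ t < r}` is `C[i,r−1]`
and `{t ∈ W : r < t ≤ i}` is `C[r+1,i]`.) -/
theorem stmt9 {n m : ℕ} {A : Type*} (α β : ℝ)
    (hα0 : 0 < α) (hα : α < 1 / 8) (hβ : β = Real.sqrt (8 * α))
    (G : SimpleGraph (Fin n)) [DecidableRel G.Adj]
    (S Z : Fin n → List A) (hSlen : ∀ j, (S j).length = m)
    (hLCS : ∀ i j : Fin n, i ≠ j → ((lcsLen (S i) (S j) : ℕ) : ℝ) ≤ α * m)
    (hsub : ∀ t, (Z t).Sublist (S t))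
    (hZlen : ∀ t, Z t ≠ [] → β * m ≤ ((Z t).length : ℝ))
    (i : Fin n) (hi : Z i ≠ []) :
    (∀ σ : ℕ → ℕ, IsAlignment (L1str Z) (JLY G S i) σ →
      HalfAligned σ Z i (i.val * m) (JLY G S i).length →
      ∀ j : Fin n, i < j → Z j ≠ [] →
        HitsSegment σ Z j ((j.val - 1) * m) (j.val * m) →
        ∃ r : Fin n, i < r ∧ r ≤ j ∧
          ((Finset.univ.filter (fun t : Fin n => Z t ≠ [] ∧ i ≤ t ∧ t < r)).card : ℝ)
            ≤ (2 * α / β) * ((r.val : ℝ) - i.val)) ∧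
    (∀ σ' : ℕ → ℕ, IsAlignment (L1str Z) (JLY' G S i) σ' →
      HalfAligned σ' Z i 0 ((numNbrLT G i + 1 + i.val) * m) →
      ∀ j : Fin n, j < i → Z j ≠ [] →
        HitsSegment σ' Z j ((numNbrLT G i + 1 + j.val) * m)
          ((numNbrLT G i + 1 + j.val + 1) * m) →
        ∃ r : Fin n, j ≤ r ∧ r < i ∧
          ((Finset.univ.filter (fun t : Fin n => Z t ≠ [] ∧ r < t ∧ t ≤ i)).card : ℝ)
            ≤ (2 * α / β) * ((i.val : ℝ) - r.val)) := by
  have hli : 0 < (Z i).length := List.length_pos_iff.mpr hi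
  have hm : 0 < m := by
    have := (hsub i).length_le
    rw [hSlen] at this; omega
  have hmR : (0 : ℝ) < m := by exact_mod_cast hm
  set h := ((Z i).length + 1) / 2 with hh
  have hhpos : 0 < h := by omega
  have hhle : h ≤ (Z i).length := by omega
  have hhR : β * m / 2 ≤ (h : ℝ) := by
    have h1 := hZlen i hi
    have h2 : (Z i).length ≤ 2 * h := by omega
    have h3 : ((Z i).length : ℝ) ≤ 2 * h := by exact_mod_cast h2
    linarith
  constructor
  · intro σ hσ hhalf j hij hj hhit
    obtain ⟨r, hr, hmin⟩ : ∃ r : Fin n, (i < r ∧ r ≤ j ∧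
        HitsSegment σ Z r ((r.val - 1) * m) (r.val * m)) ∧
        ∀ t : Fin n, i < t → t < r → ¬ HitsSegment σ Z t ((t.val - 1) * m) (t.val * m) := by
      let F := Finset.univ.filter (fun r : Fin n => i < r ∧ r ≤ j ∧
        HitsSegment σ Z r ((r.val - 1) * m) (r.val * m))
      have hF : F.Nonempty := ⟨j, by simp only [F, Finset.mem_filter]; exact ⟨Finset.mem_univ _, hij, le_rfl, hhit⟩⟩
      have h1 := F.min'_mem hF
      refine ⟨F.min' hF, (Finset.mem_filter.mp h1).2, ?_⟩
      intro t h2 h3 h4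
      have : t ∈ F := Finset.mem_filter.mpr ⟨Finset.mem_univ _, h2,
        h3.le.trans (Finset.mem_filter.mp h1).2.2.1, h4⟩
      exact absurd (F.min'_le t this) (not_le.mpr h3)
    obtain ⟨hir, hrj, q, hq1, hq2, hq3, hq4⟩ := hr
    refine ⟨r, hir, hrj, ?_⟩
    have hlenr := aux_len Z r
    have hsplit := aux_off_split Z i r hir
    set a := blockOffset Z i + (Z i).length - h with ha
    have hstart : i.val * m ≤ σ a := by
      rcases hhalf with H | H
      · have := (H (blockOffset Z i) le_rfl (by omega)).1
        rcases Nat.eq_or_lt_of_le (show blockOffset Z i ≤ a by omega) with e | e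
        · rw [← e]; exact this
        · exact this.trans (hσ.1 _ _ e (by omega)).le
      · exact (H a le_rfl (by omega)).1
    have hrange : ∀ p, a ≤ p → p < blockOffset Z r → i.val ≤ σ p / m ∧ σ p / m < r.val := by
      intro p h1 h2
      constructor
      · rw [Nat.le_div_iff_mul_le hm]
        rcases Nat.eq_or_lt_of_le h1 with e | e
        · rw [← e]; exact hstart
        · exact hstart.trans (hσ.1 _ _ e (by omega)).le
      · rw [Nat.div_lt_iff_lt_mul hm]
        exact (hσ.1 p q (by omega) (by omega)).trans hq4
    set T := Finset.univ.filter (fun t : Fin n => Z t ≠ [] ∧ i ≤ t ∧ t < r) with hTdef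
    have hcore := aux_core α S Z hSlen hm hLCS hsub (JLX G i) σ hσ a (blockOffset Z r) i.val
      (r.val - i.val) (by omega) (by omega) T (by
        intro p h1 h2
        have := hrange p h1 h2
        have : i.val < r.val := hir
        omega) (by
        intro p t h1 h2 h3 h4
        obtain ⟨g1, g2⟩ := hrange p h1 h2
        have hit : i ≤ t := by
          by_contra hc
          have := aux_off_le Z t i (not_le.mp hc)
          omega
        have htr : t < r := by
          by_contra hc
          rcases (not_lt.mp hc).eq_or_lt with e | e
          · rw [← e] at h3; omega
          · have := aux_off_le Z r t e
            omega
        have hne : Z t ≠ [] := by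
          intro e; rw [e] at h4; simp at h4; omega
        refine ⟨by simp only [T, Finset.mem_filter]; exact ⟨Finset.mem_univ _, hne, hit, htr⟩, ?_⟩
        refine ⟨⟨σ p / m + 1, by omega⟩, aux_X G i _ _ g1 rfl, ?_⟩
        intro e
        have ev : σ p / m + 1 = t.val := congrArg Fin.val e
        refine hmin t (Fin.lt_def.mpr (by omega)) htr ⟨p, h3, h4, ?_, ?_⟩
        · rw [← Nat.le_div_iff_mul_le hm]; omega
        · rw [← Nat.div_lt_iff_lt_mul hm]; omega)
    have hTins : T = insert i ((Finset.univ.filter (fun u : Fin n => i < u ∧ u < r)).filter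
        (fun t => Z t ≠ [])) := by
      ext t
      simp only [T, Finset.mem_filter, Finset.mem_univ, true_and, Finset.mem_insert]
      constructor
      · rintro ⟨h1, h2, h3⟩
        rcases h2.eq_or_lt with e | e
        · exact Or.inl e.symm
        · exact Or.inr ⟨⟨e, h3⟩, h1⟩
      · rintro (rfl | ⟨⟨h1, h2⟩, h3⟩)
        · exact ⟨hi, le_rfl, hir⟩
        · exact ⟨h3, h1.le, h2⟩
    have hsum := aux_sum Z (β * m) hZlen (Finset.univ.filter (fun u : Fin n => i < u ∧ u < r))
    have hcard : T.card = ((Finset.univ.filter (fun u : Fin n => i < u ∧ u < r)).filter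
        (fun t => Z t ≠ [])).card + 1 := by
      rw [hTins, Finset.card_insert_of_notMem (by simp)]
    have hcardR : (T.card : ℝ) = (((Finset.univ.filter (fun u : Fin n => i < u ∧ u < r)).filter
        (fun t => Z t ≠ [])).card : ℝ) + 1 := by rw [hcard]; push_cast; rfl
    have hP : blockOffset Z r - a = h +
        ∑ u ∈ Finset.univ.filter (fun u : Fin n => i < u ∧ u < r), (Z u).length := by omega
    have hPR : ((blockOffset Z r - a : ℕ) : ℝ) = h +
        ((∑ u ∈ Finset.univ.filter (fun u : Fin n => i < u ∧ u < r), (Z u).length : ℕ) : ℝ) := by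
      rw [hP, Nat.cast_add]
    rw [Nat.cast_sub (le_of_lt (Fin.lt_def.mp hir))] at hcore
    refine aux_arith α β m _ _ _ hα0 hα hβ hmR ?_ hcore ?_
    · rw [hcardR]; linarith [Nat.cast_nonneg (α := ℝ) ((Finset.univ.filter (fun u : Fin n => i < u ∧ u < r)).filter
        (fun t => Z t ≠ [])).card]
    · rw [hPR, hcardR]; linarith
  · intro σ hσ hhalf j hij hj hhit
    set d := numNbrLT G i + 1 with hd
    obtain ⟨r, hr, hmax⟩ : ∃ r : Fin n, (r < i ∧ j ≤ r ∧
        HitsSegment σ Z r ((d + r.val) * m) ((d + r.val + 1) * m)) ∧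
        ∀ t : Fin n, t < i → r < t →
          ¬ HitsSegment σ Z t ((d + t.val) * m) ((d + t.val + 1) * m) := by
      let F := Finset.univ.filter (fun r : Fin n => r < i ∧ j ≤ r ∧
        HitsSegment σ Z r ((d + r.val) * m) ((d + r.val + 1) * m))
      have hF : F.Nonempty := ⟨j, by simp only [F, Finset.mem_filter]; exact ⟨Finset.mem_univ _, hij, le_rfl, hhit⟩⟩
      have h1 := F.max'_mem hF
      refine ⟨F.max' hF, (Finset.mem_filter.mp h1).2, ?_⟩
      intro t h2 h3 h4
      have : t ∈ F := Finset.mem_filter.mpr ⟨Finset.mem_univ _, h2,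
        (Finset.mem_filter.mp h1).2.2.1.trans h3.le, h4⟩
      exact absurd (F.le_max' t this) (not_le.mpr h3)
    obtain ⟨hri, hjr, q, hq1, hq2, hq3, hq4⟩ := hr
    refine ⟨r, hjr, hri, ?_⟩
    have hleni := aux_len Z i
    have hsplit := aux_off_split Z r i hri
    have hri' : r.val < i.val := hri
    set a := blockOffset Z r + (Z r).length with ha
    set b := blockOffset Z i + h with hb
    have hend : σ (b - 1) < (d + i.val) * m := by
      rcases hhalf with H | H
      · exact (H (b - 1) (by omega) (by omega)).2
      · have := (H (blockOffset Z i + (Z i).length - 1) (by omega) (by omega)).2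
        rcases Nat.eq_or_lt_of_le (show b - 1 ≤ blockOffset Z i + (Z i).length - 1 by omega) with e | e
        · rw [e]; exact this
        · exact (hσ.1 _ _ e (by omega)).trans this
    have hrange : ∀ p, a ≤ p → p < b → d + r.val ≤ σ p / m ∧ σ p / m < d + i.val := by
      intro p h1 h2
      constructor
      · rw [Nat.le_div_iff_mul_le hm]
        exact hq3.trans (hσ.1 q p (by omega) (by omega)).le
      · rw [Nat.div_lt_iff_lt_mul hm]
        rcases Nat.eq_or_lt_of_le (show p ≤ b - 1 by omega) with e | e
        · rw [e]; exact hend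
        · exact (hσ.1 _ _ e (by omega)).trans hend
    set T := Finset.univ.filter (fun t : Fin n => Z t ≠ [] ∧ r < t ∧ t ≤ i) with hTdef
    have hcore := aux_core α S Z hSlen hm hLCS hsub (JLX' G i) σ hσ a b (d + r.val)
      (i.val - r.val) (by omega) (by omega) T (by
        intro p h1 h2
        have := hrange p h1 h2
        omega) (by
        intro p t h1 h2 h3 h4
        obtain ⟨g1, g2⟩ := hrange p h1 h2
        have hit : t ≤ i := by
          by_contra hc
          have := aux_off_le Z i t (not_le.mp hc)
          omega
        have htr : r < t := by
          by_contra hc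
          rcases (not_lt.mp hc).eq_or_lt with e | e
          · rw [e] at h4; omega
          · have := aux_off_le Z t r e
            omega
        have hne : Z t ≠ [] := by
          intro e; rw [e] at h4; simp at h4; omega
        refine ⟨by simp only [T, Finset.mem_filter]; exact ⟨Finset.mem_univ _, hne, htr, hit⟩, ?_⟩
        have hx := aux_X' G i ⟨σ p / m - d, by omega⟩ (Fin.lt_def.mpr (by simp only; omega))
        rw [← hd] at hx
        simp only at hx
        rw [Nat.add_sub_cancel' (by omega)] at hx
        refine ⟨_, hx, ?_⟩
        intro e
        have ev : σ p / m - d = t.val := congrArg Fin.val e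
        refine hmax t (Fin.lt_def.mpr (by omega)) htr ⟨p, h3, h4, ?_, ?_⟩
        · rw [← Nat.le_div_iff_mul_le hm]; omega
        · rw [← Nat.div_lt_iff_lt_mul hm]; omega)
    have hTins : T = insert i ((Finset.univ.filter (fun u : Fin n => r < u ∧ u < i)).filter
        (fun t => Z t ≠ [])) := by
      ext t
      simp only [T, Finset.mem_filter, Finset.mem_univ, true_and, Finset.mem_insert]
      constructor
      · rintro ⟨h1, h2, h3⟩
        rcases h3.eq_or_lt with e | e
        · exact Or.inl e
        · exact Or.inr ⟨⟨h2, e⟩, h1⟩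
      · rintro (rfl | ⟨⟨h1, h2⟩, h3⟩)
        · exact ⟨hi, hri, le_rfl⟩
        · exact ⟨h3, h1, h2.le⟩
    have hsum := aux_sum Z (β * m) hZlen (Finset.univ.filter (fun u : Fin n => r < u ∧ u < i))
    have hcard : T.card = ((Finset.univ.filter (fun u : Fin n => r < u ∧ u < i)).filter
        (fun t => Z t ≠ [])).card + 1 := by
      rw [hTins, Finset.card_insert_of_notMem (by simp)]
    have hcardR : (T.card : ℝ) = (((Finset.univ.filter (fun u : Fin n => r < u ∧ u < i)).filter
        (fun t => Z t ≠ [])).card : ℝ) + 1 := by rw [hcard]; push_cast; rfl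
    have hP : b - a = h +
        ∑ u ∈ Finset.univ.filter (fun u : Fin n => r < u ∧ u < i), (Z u).length := by omega
    have hPR : ((b - a : ℕ) : ℝ) = h +
        ((∑ u ∈ Finset.univ.filter (fun u : Fin n => r < u ∧ u < i), (Z u).length : ℕ) : ℝ) := by
      rw [hP, Nat.cast_add]
    rw [Nat.cast_sub hri'.le] at hcore
    refine aux_arith α β m _ _ _ hα0 hα hβ hmR ?_ hcore ?_
    · rw [hcardR]; linarith [Nat.cast_nonneg (α := ℝ) ((Finset.univ.filter (fun u : Fin n => r < u ∧ u < i)).filter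
        (fun t => Z t ≠ [])).card]
    · rw [hPR, hcardR]; linarith
end
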